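/- Let s₊ and s₋ be Lie algebras over a field K with bases {Z_p} and {z^p} (p in a finite index set) and structure constants [Z_p,Z_q] = f^r_{pq} Z_r, [z^p,z^q] = c^{pq}_r z^r. Suppose the compatibility conditions c^{pq}_r f^r_{st} = c^{pr}_s f^q_{rt} + c^{rq}_s f^p_{rt} + c^{pr}_t f^q_{sr} + c^{rq}_t f^p_{sr} hold for all indices. Then the bracket on the vector space s₊ ⊕ s₋ defined by the given brackets on each summand together with [z^p, Z_q] := f^p_{qr} z^r − c^{pr}_q Z_r satisfies the Jacobi identity, i.e., defines a Lie algebra structure (the Drinfeld double). -/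

import Mathlib

open Finset

/-- Structure constants of the Drinfeld double `ḡ = s₊ ⊕ s₋` built from the structure
constants `f` of `s₊` (basis `Z_p ↔ Sum.inl p`) and `c` of `s₋` (basis `z^p ↔ Sum.inr p`),
with crossed bracket `[z^p, Z_q] = f^p_{qr} z^r − c^{pr}_q Z_r`.
Convention: `f p q r = f^r_{p,q}` and `c p q r = c^{p,q}_r`. -/
def doubleStr {K : Type*} [Field K] {ι : Type*} (f c : ι → ι → ι → K) :
    ι ⊕ ι → ι ⊕ ι → ι ⊕ ι → K
  | Sum.inl p, Sum.inl q, Sum.inl r => f p q r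
  | Sum.inr p, Sum.inr q, Sum.inr r => c p q r
  | Sum.inr p, Sum.inl q, Sum.inr r => f q r p
  | Sum.inr p, Sum.inl q, Sum.inl r => -(c p r q)
  | Sum.inl q, Sum.inr p, Sum.inr r => -(f q r p)
  | Sum.inl q, Sum.inr p, Sum.inl r => c p r q
  | _, _, _ => 0

/-- The bracket on `ḡ = s₊ ⊕ s₋` (coordinates with respect to the basis `{Z_p, z^p}`). -/
def doubleBracket {K : Type*} [Field K] {ι : Type*} [Fintype ι] (f c : ι → ι → ι → K)
    (x y : ι ⊕ ι → K) : ι ⊕ ι → K :=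
  fun w => ∑ u, ∑ v, x u * y v * doubleStr f c u v w

/-- The Jacobi expression in structure constants. -/
def jacStr {K : Type*} [Field K] {ι : Type*} [Fintype ι] (f c : ι → ι → ι → K)
    (a b d w : ι ⊕ ι) : K :=
  ∑ u, (doubleStr f c a b u * doubleStr f c u d w + doubleStr f c b d u * doubleStr f c u a w
    + doubleStr f c d a u * doubleStr f c u b w)

theorem jacStr_cyc {K : Type*} [Field K] {ι : Type*} [Fintype ι] (f c : ι → ι → ι → K)
    (a b d w : ι ⊕ ι) : jacStr f c a b d w = jacStr f c b d a w := by
  unfold jacStr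
  exact Finset.sum_congr rfl fun u _ => by ring

theorem jacStr_zero {K : Type*} [Field K] {ι : Type*} [Fintype ι]
    (f c : ι → ι → ι → K)
    (hfa : ∀ p q r, f p q r = -f q p r)
    (hca : ∀ p q r, c p q r = -c q p r)
    (hfj : ∀ p q s t, ∑ r, (f p q r * f r s t + f q s r * f r p t + f s p r * f r q t) = 0)
    (hcj : ∀ p q s t, ∑ r, (c p q r * c r s t + c q s r * c r p t + c s p r * c r q t) = 0)
    (hcomp : ∀ p q s t, ∑ r, c p q r * f s t r =
      ∑ r, (c p r s * f r t q + c r q s * f r t p + c p r t * f s r q + c r q t * f s r p))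
    (a b d w : ι ⊕ ι) : jacStr f c a b d w = 0 := by
  have hcomp' : ∀ p q s t, ∑ r, (c p q r * f s t r -
      (c p r s * f r t q + c r q s * f r t p + c p r t * f s r q + c r q t * f s r p)) = 0 := by
    intro p q s t
    rw [Finset.sum_sub_distrib, hcomp, sub_self]
  have llr : ∀ p q s w, jacStr f c (.inl p) (.inl q) (.inr s) w = 0 := by
    rintro p q s (t | t)
    · simp only [jacStr, Fintype.sum_sum_type, doubleStr, ← Finset.sum_add_distrib]
      refine Eq.trans (Finset.sum_congr rfl fun r _ => ?_) (hcomp' s t p q)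
      grind
    · simp only [jacStr, Fintype.sum_sum_type, doubleStr, ← Finset.sum_add_distrib]
      rw [← neg_eq_zero, ← Finset.sum_neg_distrib]
      refine Eq.trans (Finset.sum_congr rfl fun r _ => ?_) (hfj p q t s)
      grind
  have rrl : ∀ p q s w, jacStr f c (.inr p) (.inr q) (.inl s) w = 0 := by
    rintro p q s (t | t)
    · simp only [jacStr, Fintype.sum_sum_type, doubleStr, ← Finset.sum_add_distrib]
      rw [← neg_eq_zero, ← Finset.sum_neg_distrib]
      refine Eq.trans (Finset.sum_congr rfl fun r _ => ?_) (hcj p q t s)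
      grind
    · simp only [jacStr, Fintype.sum_sum_type, doubleStr, ← Finset.sum_add_distrib]
      refine Eq.trans (Finset.sum_congr rfl fun r _ => ?_) (hcomp' p q s t)
      grind
  rcases a with p | p <;> rcases b with q | q <;> rcases d with s | s
  · rcases w with t | t
    · simp [jacStr, doubleStr, hfj]
    · simp [jacStr, doubleStr]
  · exact llr _ _ _ _
  · rw [jacStr_cyc, jacStr_cyc]; exact llr _ _ _ _
  · rw [jacStr_cyc]; exact rrl _ _ _ _
  · rw [jacStr_cyc]; exact llr _ _ _ _
  · rw [jacStr_cyc, jacStr_cyc]; exact rrl _ _ _ _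
  · exact rrl _ _ _ _
  · rcases w with t | t
    · simp [jacStr, doubleStr]
    · simp [jacStr, doubleStr, hcj]

theorem doubleBracket_expand {K : Type*} [Field K] {ι : Type*} [Fintype ι]
    (f c : ι → ι → ι → K) (x y z : ι ⊕ ι → K) (w : ι ⊕ ι) :
    doubleBracket f c (doubleBracket f c x y) z w =
      ∑ a, ∑ b, ∑ d, x a * y b * z d *
        ∑ u, doubleStr f c a b u * doubleStr f c u d w := by
  simp only [doubleBracket, Finset.sum_mul, Finset.mul_sum]
  -- bring the sum over u innermost
  calc _ = ∑ u, ∑ a, ∑ d, ∑ b, x a * y b * doubleStr f c a b u * z d * doubleStr f c u d w :=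
        Finset.sum_congr rfl fun u _ => Finset.sum_comm
    _ = ∑ a, ∑ u, ∑ d, ∑ b, x a * y b * doubleStr f c a b u * z d * doubleStr f c u d w :=
        Finset.sum_comm
    _ = _ := Finset.sum_congr rfl fun a _ => by
      calc _ = ∑ u, ∑ b, ∑ d, x a * y b * doubleStr f c a b u * z d * doubleStr f c u d w :=
            Finset.sum_congr rfl fun u _ => Finset.sum_comm
        _ = ∑ b, ∑ u, ∑ d, x a * y b * doubleStr f c a b u * z d * doubleStr f c u d w :=
            Finset.sum_comm
        _ = _ := Finset.sum_congr rfl fun b _ => by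
          rw [Finset.sum_comm]
          exact Finset.sum_congr rfl fun d _ => Finset.sum_congr rfl fun u _ => by ring

/-- if `s₊` and `s₋` are Lie algebras (antisymmetric structure constants
satisfying the Jacobi identity) and the compatibility conditions
`c^{pq}_r f^r_{st} = c^{pr}_s f^q_{rt} + c^{rq}_s f^p_{rt} + c^{pr}_t f^q_{sr} + c^{rq}_t f^p_{sr}`
hold, then the Drinfeld double bracket satisfies the Jacobi identity. -/
theorem drinfeld_double_jacobi {K : Type*} [Field K] {ι : Type*} [Fintype ι]
    (f c : ι → ι → ι → K)
    (hfa : ∀ p q r, f p q r = -f q p r)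
    (hca : ∀ p q r, c p q r = -c q p r)
    (hfj : ∀ p q s t, ∑ r, (f p q r * f r s t + f q s r * f r p t + f s p r * f r q t) = 0)
    (hcj : ∀ p q s t, ∑ r, (c p q r * c r s t + c q s r * c r p t + c s p r * c r q t) = 0)
    (hcomp : ∀ p q s t, ∑ r, c p q r * f s t r =
      ∑ r, (c p r s * f r t q + c r q s * f r t p + c p r t * f s r q + c r q t * f s r p)) :
    ∀ x y z : ι ⊕ ι → K,
      doubleBracket f c (doubleBracket f c x y) z +
        doubleBracket f c (doubleBracket f c y z) x +
        doubleBracket f c (doubleBracket f c z x) y = 0 := by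
  intro x y z
  funext w
  simp only [Pi.add_apply, Pi.zero_apply, doubleBracket_expand]
  have h2 : ∀ F : ι ⊕ ι → ι ⊕ ι → ι ⊕ ι → K,
      ∑ b, ∑ d, ∑ a, F b d a = ∑ a, ∑ b, ∑ d, F b d a := by
    intro F
    rw [Finset.sum_comm]
    calc _ = ∑ d, ∑ a, ∑ b, F b d a := Finset.sum_congr rfl fun d _ => Finset.sum_comm
      _ = ∑ a, ∑ d, ∑ b, F b d a := Finset.sum_comm
      _ = _ := Finset.sum_congr rfl fun a _ => Finset.sum_comm
  rw [h2 (fun b d a => y b * z d * x a * ∑ u, doubleStr f c b d u * doubleStr f c u a w),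
    ← h2 (fun a b d => z d * x a * y b * ∑ u, doubleStr f c d a u * doubleStr f c u b w)]
  simp only [← Finset.sum_add_distrib]
  refine Finset.sum_eq_zero fun a _ => Finset.sum_eq_zero fun b _ =>
    Finset.sum_eq_zero fun d _ => ?_
  have h := jacStr_zero f c hfa hca hfj hcj hcomp a b d w
  simp only [jacStr, Finset.sum_add_distrib] at h
  linear_combination x a * y b * z d * h
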